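/- Let n ≥ 1. Let f be a Schwartz function on ℝⁿ with all moments vanishing, i.e. ∫_{ℝⁿ} f(x) x^α dx = 0 for every multi-index α, and let g be any Schwartz function on ℝⁿ. Then f ∗ D_ε g → 0 in the topology of the Schwartz space as ε → 0⁺. More precisely, for every N ∈ ℕ and every multi-index I there exist constants C > 0 and γ > 0 such that sup_{x∈ℝⁿ} (1+|x|)^N |∂^I (f ∗ D_ε g)(x)| ≤ C ε^γ for all 0 < ε < 1. -/

import Mathlib

open MeasureTheory SchwartzMap Filter Topology FourierTransform
open scoped ENNReal ContDiff

noncomputable section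

/-- Euclidean space ℝⁿ. -/
abbrev Euc (n : ℕ) := EuclideanSpace ℝ (Fin n)

/-- Convolution of two functions on ℝⁿ: (f ∗ g)(x) = ∫ f(y) g(x − y) dy. -/
def conv {n : ℕ} (f g : Euc n → ℂ) : Euc n → ℂ := fun x => ∫ y, f y * g (x - y)

/-- L¹-normalized dilation: (D_t f)(x) = tⁿ f(t x). -/
def dil (n : ℕ) (t : ℝ) (f : Euc n → ℂ) : Euc n → ℂ := fun x => (t ^ n : ℝ) • f (t • x)

/-- f^*(x) = conj (f (−x)). -/
def starF {n : ℕ} (f : Euc n → ℂ) : Euc n → ℂ := fun x => (starRingEnd ℂ) (f (-x))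

/-- The monomial x ↦ x^α for a multi-index α. -/
def monom {n : ℕ} (α : Fin n → ℕ) (x : Euc n) : ℂ := ∏ i, (x i : ℂ) ^ α i

/-- f has vanishing moments of order k: ∫ f(x) x^α dx = 0 (converging absolutely)
for all multi-indices α with |α| ≤ k − 1, i.e. |α| < k. -/
def HasVanishingMoments {n : ℕ} (k : ℕ) (f : Euc n → ℂ) : Prop :=
  ∀ α : Fin n → ℕ, (∑ i, α i) < k →
    Integrable (fun x => f x * monom α x) ∧ (∫ x, f x * monom α x) = 0

/-- All moments of f vanish (with absolute convergence of all the integrals). -/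
def AllMomentsVanish {n : ℕ} (f : Euc n → ℂ) : Prop :=
  ∀ α : Fin n → ℕ,
    Integrable (fun x => f x * monom α x) ∧ (∫ x, f x * monom α x) = 0

/-- f has decay order N: |f(x)| ≤ C (1 + |x|)^{−N}. -/
def HasDecayOrder {n : ℕ} (N : ℕ) (f : Euc n → ℂ) : Prop :=
  ∃ C : ℝ, ∀ x, ‖f x‖ ≤ C / (1 + ‖x‖) ^ N

/-- Partial derivative in the i-th coordinate direction. -/
def pd {n : ℕ} (i : Fin n) (f : Euc n → ℂ) : Euc n → ℂ :=
  fun x => fderiv ℝ f x (EuclideanSpace.single i (1 : ℝ))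

/-- Iterated partial derivative ∂^α along a multi-index α. -/
def mderiv {n : ℕ} (α : Fin n → ℕ) (f : Euc n → ℂ) : Euc n → ℂ :=
  (List.finRange n).foldr (fun i g => (pd i)^[α i] g) f

/-- Schwartz-type seminorm (valued in [0,∞]): sup over x of (1+|x|)^k ‖D^m f(x)‖. -/
def schwartzSemi {n : ℕ} (k m : ℕ) (f : Euc n → ℂ) : ℝ≥0∞ :=
  ⨆ x, ENNReal.ofReal ((1 + ‖x‖) ^ k * ‖iteratedFDeriv ℝ m f x‖)

/-- Convergence in the topology of the Schwartz space, along a filter `l`: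
all Schwartz seminorms of the difference tend to 0. -/
def TendstoSchwartz {n : ℕ} {ι : Type*} (l : Filter ι) (F : ι → Euc n → ℂ)
    (f : Euc n → ℂ) : Prop :=
  ∀ k m : ℕ, Tendsto (fun N => schwartzSemi k m (fun x => F N x - f x)) l (nhds 0)

/-- A pair (ψ, η) of Schwartz functions is LP-admissible: for every Schwartz function f
with all moments vanishing, ∑_{|j| ≤ N} f ∗ ψ_j^* ∗ η_j → f in the Schwartz topology. -/
def LPAdmissible {n : ℕ} (ψ η : 𝓢(Euc n, ℂ)) : Prop :=
  ∀ f : 𝓢(Euc n, ℂ), AllMomentsVanish (⇑f) →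
    TendstoSchwartz atTop
      (fun N : ℕ => fun x => ∑ j ∈ Finset.Icc (-(N : ℤ)) (N : ℤ),
        conv (conv (⇑f) (starF (dil n ((2:ℝ) ^ j) (⇑ψ)))) (dil n ((2:ℝ) ^ j) (⇑η)) x)
      (⇑f)

/-- A Schwartz function ψ is admissible: for every Schwartz f with all moments vanishing,
∫_ε^A f ∗ D_a(ψ^* ∗ ψ) da/a → f in the Schwartz topology as ε → 0⁺, A → ∞. -/
def Admissible {n : ℕ} (ψ : 𝓢(Euc n, ℂ)) : Prop :=
  ∀ f : 𝓢(Euc n, ℂ), AllMomentsVanish (⇑f) →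
    TendstoSchwartz ((nhdsWithin (0:ℝ) (Set.Ioi 0)) ×ˢ (atTop : Filter ℝ))
      (fun εA : ℝ × ℝ => fun x =>
        ∫ a in Set.Ioc εA.1 εA.2, conv (⇑f) (dil n a (conv (starF ⇑ψ) ⇑ψ)) x / (a : ℂ))
      (⇑f)

section DilatedConvolution

variable {n : ℕ} {F : Type*} [NormedAddCommGroup F] [NormedSpace ℝ F]

lemma SchwartzMap.exists_one_add_norm_pow_mul_le (h : 𝓢(Euc n, F)) (N m : ℕ) :
    ∃ C : ℝ, 0 ≤ C ∧ ∀ x, (1 + ‖x‖) ^ N * ‖iteratedFDeriv ℝ m h x‖ ≤ C := by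
  refine ⟨_, ?_, fun x => one_add_le_sup_seminorm_apply (𝕜 := ℝ) (m := (N, m)) le_rfl le_rfl h x⟩
  positivity

lemma SchwartzMap.exists_taylor_remainder_le [CompleteSpace F] (h : 𝓢(Euc n, F)) (L N : ℕ) :
    ∃ C : ℝ, 0 ≤ C ∧ ∀ u v : Euc n, (1 + ‖u‖) ^ N *
      ‖h (u + v) - ∑ k ∈ Finset.range (L + 1),
        (k.factorial : ℝ)⁻¹ • iteratedFDeriv ℝ k h u (fun _ => v)‖ ≤
      C * ‖v‖ ^ (L + 1) * (1 + ‖v‖) ^ N := by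
  obtain ⟨C, hC0, hC⟩ := h.exists_one_add_norm_pow_mul_le N (L + 1)
  refine ⟨C, hC0, fun u v => ?_⟩
  rw [map_add_eq_sum_add_integral_iteratedFDeriv (n := L)
    (fun t _ => (h.smooth (L + 1)).contDiffAt), add_sub_cancel_left, norm_smul]
  have hu : 0 < (1 + ‖u‖) ^ N := by positivity
  have key : ∀ t ∈ Set.uIoc (0 : ℝ) 1,
      ‖(1 - t) ^ L • iteratedFDeriv ℝ (L + 1) h (u + t • v) (fun _ => v)‖ ≤
        C * ‖v‖ ^ (L + 1) * (1 + ‖v‖) ^ N / (1 + ‖u‖) ^ N := by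
    intro t ht
    rw [Set.uIoc_of_le zero_le_one] at ht
    have h1 : ‖(1 - t) ^ L‖ ≤ 1 := by
      rw [Real.norm_eq_abs, abs_of_nonneg (pow_nonneg (by linarith [ht.2]) _)]
      exact pow_le_one₀ (by linarith [ht.2]) (by linarith [ht.1])
    have h2 : ‖iteratedFDeriv ℝ (L + 1) h (u + t • v) (fun _ => v)‖ ≤
        ‖iteratedFDeriv ℝ (L + 1) h (u + t • v)‖ * ‖v‖ ^ (L + 1) := by
      simpa using (iteratedFDeriv ℝ (L + 1) h (u + t • v)).le_opNorm (fun _ => v)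
    have htv : ‖t • v‖ ≤ ‖v‖ := by
      rw [norm_smul, Real.norm_eq_abs, abs_of_pos ht.1]
      exact mul_le_of_le_one_left (norm_nonneg _) ht.2
    have h3 : 1 + ‖u‖ ≤ (1 + ‖u + t • v‖) * (1 + ‖v‖) := by
      have := norm_sub_le (u + t • v) (t • v)
      rw [add_sub_cancel_right] at this
      nlinarith [norm_nonneg (u + t • v), norm_nonneg v]
    rw [norm_smul, le_div_iff₀ hu]
    calc _ ≤ 1 * (‖iteratedFDeriv ℝ (L + 1) h (u + t • v)‖ * ‖v‖ ^ (L + 1)) *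
          ((1 + ‖u + t • v‖) * (1 + ‖v‖)) ^ N := by gcongr
      _ = ((1 + ‖u + t • v‖) ^ N * ‖iteratedFDeriv ℝ (L + 1) h (u + t • v)‖) *
          ‖v‖ ^ (L + 1) * (1 + ‖v‖) ^ N := by rw [mul_pow]; ring
      _ ≤ _ := by gcongr; exact hC _
  have hint := intervalIntegral.norm_integral_le_of_norm_le_const key
  rw [sub_zero, abs_one, mul_one] at hint
  have hfac : ‖(L.factorial : ℝ)⁻¹‖ ≤ 1 := by
    rw [norm_inv, Real.norm_natCast]
    exact inv_le_one_of_one_le₀ (mod_cast Nat.one_le_iff_ne_zero.2 L.factorial_ne_zero)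
  calc _ ≤ (1 + ‖u‖) ^ N * (1 * (C * ‖v‖ ^ (L + 1) * (1 + ‖v‖) ^ N / (1 + ‖u‖) ^ N)) := by
        gcongr
    _ = _ := by field_simp

variable [NormedSpace ℂ F]

/-- The vector-valued convolution `∫ f(y) h(ε (x - y)) dy` of `f` with the unnormalized dilation
of `h` by `ε`. -/
def dilConv (f : Euc n → ℂ) (h : Euc n → F) (ε : ℝ) (x : Euc n) : F :=
  ∫ y, f y • h (ε • (x - y))

lemma conv_dil_eq_smul_dilConv (f g : Euc n → ℂ) (ε : ℝ) :
    conv f (dil n ε g) = fun x => ε ^ n • dilConv f g ε x := by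
  ext x
  simp only [conv, dil, dilConv, ← integral_smul, smul_eq_mul, mul_smul_comm]


lemma AllMomentsVanish.integral_smul_multilinear [CompleteSpace F] [IsScalarTower ℝ ℂ F]
    {f : Euc n → ℂ} (hf : AllMomentsVanish f) {k : ℕ} (T : Euc n [×k]→L[ℝ] F) :
    Integrable (fun y => f y • T (fun _ => y)) ∧ ∫ y, f y • T (fun _ => y) = 0 := by
  have expand : ∀ y : Euc n, f y • T (fun _ => y) = ∑ r : Fin k → Fin n,
      (f y * monom (fun i => (Finset.univ.filter (fun j => r j = i)).card) y) •
        T (fun j => EuclideanSpace.single (r j) (1 : ℝ)) := by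
    intro y
    have hy : y = ∑ i, y i • EuclideanSpace.single i (1 : ℝ) := by
      simpa using ((EuclideanSpace.basisFun (Fin n) ℝ).sum_repr y).symm
    have hT : T (fun _ => y) = ∑ r : Fin k → Fin n,
        T (fun j => y (r j) • EuclideanSpace.single (r j) (1 : ℝ)) := by
      conv_lhs => rw [hy]
      exact T.map_sum (fun _ i => y i • EuclideanSpace.single i (1 : ℝ))
    rw [hT, Finset.smul_sum]
    refine Finset.sum_congr rfl fun r _ => ?_
    rw [T.map_smul_univ, mul_smul]
    congr 1
    rw [← algebraMap_smul ℂ, monom]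
    congr 1
    rw [Complex.coe_algebraMap]
    push_cast
    rw [← Finset.prod_fiberwise (Finset.univ) r]
    refine Finset.prod_congr rfl fun i _ => ?_
    rw [Finset.prod_congr rfl (g := fun _ => (y i : ℂ)) (by simp +contextual), Finset.prod_const]
  simp_rw [expand]
  have hint : ∀ r : Fin k → Fin n, Integrable (fun y =>
      (f y * monom (fun i => (Finset.univ.filter (fun j => r j = i)).card) y) •
        T (fun j => EuclideanSpace.single (r j) (1 : ℝ))) :=
    fun r => (hf _).1.smul_const _
  refine ⟨integrable_finsetSum _ fun r _ => hint r, ?_⟩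
  rw [integral_finsetSum _ fun r _ => hint r]
  refine Finset.sum_eq_zero fun r _ => ?_
  rw [integral_smul_const, (hf _).2, zero_smul]

lemma SchwartzMap.integrable_smul_dil (f : 𝓢(Euc n, ℂ)) (h : 𝓢(Euc n, F)) (ε : ℝ) (x : Euc n) :
    Integrable (fun y => f y • h (ε • (x - y))) := by
  obtain ⟨C, -, hC⟩ := h.exists_one_add_norm_pow_mul_le 0 0
  refine f.integrable.smul_bdd C ?_ (.of_forall fun y => by simpa using hC (ε • (x - y)))
  exact (h.continuous.comp (by fun_prop)).aestronglyMeasurable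

lemma SchwartzMap.exists_dilConv_le [CompleteSpace F] [IsScalarTower ℝ ℂ F]
    [SMulCommClass ℝ ℂ F] (f : 𝓢(Euc n, ℂ)) (hf : AllMomentsVanish f) (h : 𝓢(Euc n, F)) (N : ℕ) :
    ∃ C : ℝ, 0 ≤ C ∧ ∀ ε : ℝ, 0 < ε → ε < 1 → ∀ x : Euc n,
      (1 + ‖x‖) ^ N * ‖dilConv f h ε x‖ ≤ C * ε := by
  obtain ⟨C, hC0, hC⟩ := h.exists_taylor_remainder_le N N
  have hB : Integrable (fun y : Euc n => ‖f y‖ * (‖y‖ ^ (N + 1) * (1 + ‖y‖) ^ N)) := by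
    have : ∀ y : Euc n, ‖f y‖ * (‖y‖ ^ (N + 1) * (1 + ‖y‖) ^ N) =
        ∑ j ∈ Finset.range (N + 1), (N.choose j : ℝ) * (‖y‖ ^ (N + 1 + (N - j)) * ‖f y‖) := by
      intro y
      rw [add_pow, Finset.mul_sum, Finset.mul_sum]
      exact Finset.sum_congr rfl fun j _ => by rw [pow_add, one_pow]; ring
    simp_rw [this]
    exact integrable_finsetSum _ fun j _ => (f.integrable_pow_mul volume _).const_mul _
  refine ⟨C * ∫ y, ‖f y‖ * (‖y‖ ^ (N + 1) * (1 + ‖y‖) ^ N), by positivity,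
    fun ε h0 h1 x => ?_⟩
  have hterm : ∀ k, Integrable (fun y => f y •
        ((k.factorial : ℝ)⁻¹ • iteratedFDeriv ℝ k h (ε • x) (fun _ => -(ε • y)))) ∧
      ∫ y, f y • ((k.factorial : ℝ)⁻¹ • iteratedFDeriv ℝ k h (ε • x) (fun _ => -(ε • y))) = 0 := by
    intro k
    have e : ∀ y, f y • ((k.factorial : ℝ)⁻¹ •
        iteratedFDeriv ℝ k h (ε • x) (fun _ => -(ε • y))) =
        f y • (((k.factorial : ℝ)⁻¹ * (-ε) ^ k) • iteratedFDeriv ℝ k h (ε • x))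
          (fun _ => y) := by
      intro y
      have := (iteratedFDeriv ℝ k h (ε • x)).map_smul_univ (fun _ => -ε) (fun _ => y)
      simp only [neg_smul, Finset.prod_const, Finset.card_univ, Fintype.card_fin] at this
      rw [this, smul_smul, smul_apply]
    simp_rw [e]
    exact hf.integral_smul_multilinear _
  have harg : ∀ y, ε • x + -(ε • y) = ε • (x - y) := fun y => by rw [smul_sub, sub_eq_add_neg]
  have hrepr : dilConv f h ε x = ∫ y, f y • (h (ε • x + -(ε • y)) -
      ∑ k ∈ Finset.range (N + 1), (k.factorial : ℝ)⁻¹ •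
        iteratedFDeriv ℝ k h (ε • x) (fun _ => -(ε • y))) := by
    simp_rw [smul_sub, Finset.smul_sum]
    rw [integral_sub, integral_finsetSum _ fun k _ => (hterm k).1,
      Finset.sum_eq_zero fun k _ => (hterm k).2, sub_zero]
    · simp only [dilConv, harg]
    · simpa only [harg] using f.integrable_smul_dil h ε x
    · exact integrable_finsetSum _ fun k _ => (hterm k).1
  have hx : 0 < (1 + ‖x‖) ^ N := by positivity
  have hbound : ‖dilConv f h ε x‖ ≤ ∫ y, (C * ε / (1 + ‖x‖) ^ N) *
      (‖f y‖ * (‖y‖ ^ (N + 1) * (1 + ‖y‖) ^ N)) := by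
    rw [hrepr]
    refine norm_integral_le_of_norm_le (hB.const_mul _) (.of_forall fun y => ?_)
    rw [norm_smul, mul_left_comm]
    gcongr
    rw [div_mul_eq_mul_div, le_div_iff₀ hx]
    have hεN : 0 < ε ^ N := by positivity
    have hxε : ε ^ N * (1 + ‖x‖) ^ N ≤ (1 + ‖ε • x‖) ^ N := by
      rw [← mul_pow]
      gcongr
      rw [norm_smul, Real.norm_eq_abs, abs_of_pos h0]
      linarith
    have hyε : ‖-(ε • y)‖ = ε * ‖y‖ := by
      rw [norm_neg, norm_smul, Real.norm_eq_abs, abs_of_pos h0]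
    have hy1 : ε * ‖y‖ ≤ ‖y‖ := mul_le_of_le_one_left (norm_nonneg _) h1.le
    have := hC (ε • x) (-(ε • y))
    rw [hyε] at this
    set R := ‖h (ε • x + -(ε • y)) - ∑ k ∈ Finset.range (N + 1), (k.factorial : ℝ)⁻¹ •
        iteratedFDeriv ℝ k h (ε • x) (fun _ => -(ε • y))‖
    refine le_of_mul_le_mul_left ?_ hεN
    calc ε ^ N * (R * (1 + ‖x‖) ^ N) = ε ^ N * (1 + ‖x‖) ^ N * R := by ring
      _ ≤ (1 + ‖ε • x‖) ^ N * R := by gcongr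
      _ ≤ C * (ε * ‖y‖) ^ (N + 1) * (1 + ε * ‖y‖) ^ N := this
      _ ≤ C * (ε * ‖y‖) ^ (N + 1) * (1 + ‖y‖) ^ N := by gcongr
      _ = _ := by ring
  rw [integral_const_mul] at hbound
  calc _ ≤ (1 + ‖x‖) ^ N * (C * ε / (1 + ‖x‖) ^ N *
        ∫ y, ‖f y‖ * (‖y‖ ^ (N + 1) * (1 + ‖y‖) ^ N)) := by gcongr
    _ = _ := by
      rw [← mul_assoc, mul_div_cancel₀ _ hx.ne']
      ring

lemma SchwartzMap.hasFDerivAt_dilConv [SMulCommClass ℝ ℂ F] (f : 𝓢(Euc n, ℂ))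
    (h : 𝓢(Euc n, F)) (ε : ℝ) (x : Euc n) :
    HasFDerivAt (dilConv f h ε) (ε • dilConv f (fderivCLM ℝ (Euc n) F h) ε x) x := by
  obtain ⟨C, -, hC⟩ := (fderivCLM ℝ (Euc n) F h).exists_one_add_norm_pow_mul_le 0 0
  simp only [pow_zero, one_mul, norm_iteratedFDeriv_zero] at hC
  have hd : ∀ y x : Euc n, HasFDerivAt (fun x => f y • h (ε • (x - y)))
      (ε • f y • fderivCLM ℝ (Euc n) F h (ε • (x - y))) x := by
    intro y x
    have h1 : HasFDerivAt (fun x : Euc n => ε • (x - y))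
        (ε • ContinuousLinearMap.id ℝ (Euc n)) x :=
      ((hasFDerivAt_id x).sub_const y).const_smul ε
    have h2 := ((h.hasFDerivAt (ε • (x - y))).comp x h1).const_smul (f y)
    convert! h2 using 1
    ext v
    change ε • f y • fderiv ℝ h (ε • (x - y)) v = f y • fderiv ℝ h (ε • (x - y)) (ε • v)
    rw [map_smul, smul_comm]
  rw [dilConv, ← integral_smul]
  refine hasFDerivAt_integral_of_dominated_of_fderiv_le (bound := fun y => |ε| * (‖f y‖ * C))
    univ_mem (.of_forall fun x => (f.integrable_smul_dil h ε x).aestronglyMeasurable)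
    (f.integrable_smul_dil h ε x) ?_ (.of_forall fun y x _ => ?_)
    ((f.integrable.norm.mul_const C).const_mul _) (.of_forall fun y x _ => hd y x)
  · exact ((f.integrable_smul_dil (fderivCLM ℝ (Euc n) F h) ε x).smul ε).aestronglyMeasurable
  · rw [norm_smul, norm_smul, Real.norm_eq_abs]
    gcongr
    exact hC _

lemma SchwartzMap.fderiv_smul_dilConv [SMulCommClass ℝ ℂ F] (f : 𝓢(Euc n, ℂ)) (h : 𝓢(Euc n, F))
    (c ε : ℝ) : fderiv ℝ (fun x => c • dilConv f h ε x) =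
      fun x => (c * ε) • dilConv f (fderivCLM ℝ (Euc n) F h) ε x := by
  ext1 x
  rw [mul_smul]
  exact ((f.hasFDerivAt_dilConv h ε x).const_smul c).fderiv

/-- The scalar `c` absorbs the powers of `ε` produced by differentiating `dilConv f h ε`. -/
lemma SchwartzMap.exists_iteratedFDeriv_dilConv_le (f : 𝓢(Euc n, ℂ)) (hf : AllMomentsVanish f)
    (N m : ℕ) : ∀ {F : Type} [NormedAddCommGroup F] [NormedSpace ℝ F] [NormedSpace ℂ F]
      [CompleteSpace F] [IsScalarTower ℝ ℂ F] [SMulCommClass ℝ ℂ F] (h : 𝓢(Euc n, F)),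
    ∃ C : ℝ, 0 ≤ C ∧ ∀ c ε : ℝ, |c| ≤ 1 → 0 < ε → ε < 1 → ∀ x : Euc n,
      (1 + ‖x‖) ^ N * ‖iteratedFDeriv ℝ m (fun x => c • dilConv f h ε x) x‖ ≤ C * ε := by
  induction m with
  | zero =>
    intro F _ _ _ _ _ _ h
    obtain ⟨C, hC0, hC⟩ := f.exists_dilConv_le hf h N
    refine ⟨C, hC0, fun c ε hc h0 h1 x => le_trans ?_ (hC ε h0 h1 x)⟩
    rw [norm_iteratedFDeriv_zero, norm_smul, Real.norm_eq_abs]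
    gcongr
    exact mul_le_of_le_one_left (norm_nonneg _) hc
  | succ m ih =>
    intro F _ _ _ _ _ _ h
    obtain ⟨C, hC0, hC⟩ := ih (fderivCLM ℝ (Euc n) F h)
    refine ⟨C, hC0, fun c ε hc h0 h1 x => ?_⟩
    rw [← norm_iteratedFDeriv_fderiv, fderiv_smul_dilConv]
    refine hC (c * ε) ε ?_ h0 h1 x
    rw [abs_mul, abs_of_pos h0]
    exact mul_le_one₀ hc h0.le h1.le

open LineDeriv in
lemma pd_smul_dilConv (f h : 𝓢(Euc n, ℂ)) (c ε : ℝ) (i : Fin n) :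
    pd i (fun x => c • dilConv f h ε x) =
      fun x => (c * ε) • dilConv f (∂_{EuclideanSpace.single i (1 : ℝ)} h : 𝓢(Euc n, ℂ)) ε x := by
  ext x
  rw [pd, f.fderiv_smul_dilConv, smul_apply, dilConv,
    ContinuousLinearMap.integral_apply (f.integrable_smul_dil _ ε x)]
  rfl

lemma exists_iterate_pd_smul_dilConv (f : 𝓢(Euc n, ℂ)) (i : Fin n) (k : ℕ) (h : 𝓢(Euc n, ℂ)) :
    ∃ (h' : 𝓢(Euc n, ℂ)) (p : ℕ), ∀ c ε : ℝ, (pd i)^[k] (fun x => c • dilConv f h ε x) =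
      fun x => (c * ε ^ p) • dilConv f h' ε x := by
  induction k generalizing h with
  | zero => exact ⟨h, 0, fun c ε => by simp⟩
  | succ k ih =>
    obtain ⟨h', p, hp⟩ := ih (LineDeriv.lineDerivOp (EuclideanSpace.single i (1 : ℝ)) h)
    refine ⟨h', p + 1, fun c ε => ?_⟩
    rw [Function.iterate_succ_apply, pd_smul_dilConv, hp, mul_assoc, ← pow_succ']

lemma exists_mderiv_smul_dilConv (f h : 𝓢(Euc n, ℂ)) (α : Fin n → ℕ) :
    ∃ (h' : 𝓢(Euc n, ℂ)) (p : ℕ), ∀ c ε : ℝ, mderiv α (fun x => c • dilConv f h ε x) =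
      fun x => (c * ε ^ p) • dilConv f h' ε x := by
  unfold mderiv
  induction List.finRange n with
  | nil => exact ⟨h, 0, fun c ε => by simp⟩
  | cons i l ih =>
    obtain ⟨h₁, p, hp⟩ := ih
    obtain ⟨h₂, q, hq⟩ := exists_iterate_pd_smul_dilConv f i (α i) h₁
    refine ⟨h₂, p + q, fun c ε => ?_⟩
    rw [List.foldr_cons, hp, hq, mul_assoc, ← pow_add]

end DilatedConvolution

/-- The claim f ∗ D_ε g → 0 in S(ℝⁿ) for f ∈ Z(ℝⁿ), from the proof of Theorem 3.11 of
the paper: the convergence holds in the Schwartz topology as ε → 0⁺, and quantitatively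
each Schwartz seminorm is O(ε^γ) for some γ > 0. -/
theorem statement14 (n : ℕ) (hn : 1 ≤ n) (f g : 𝓢(Euc n, ℂ))
    (hf : AllMomentsVanish (⇑f)) :
    TendstoSchwartz (nhdsWithin (0:ℝ) (Set.Ioi 0))
      (fun ε : ℝ => conv (⇑f) (dil n ε (⇑g))) (fun _ => 0) ∧
    ∀ (N : ℕ) (I : Fin n → ℕ), ∃ C γ : ℝ, 0 < C ∧ 0 < γ ∧
      ∀ ε : ℝ, 0 < ε → ε < 1 → ∀ x : Euc n,
        (1 + ‖x‖) ^ N * ‖mderiv I (conv (⇑f) (dil n ε (⇑g))) x‖ ≤ C * ε ^ γ := by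
  refine ⟨fun k m => ?_, fun N I => ?_⟩
  · obtain ⟨C, -, hC⟩ := f.exists_iteratedFDeriv_dilConv_le hf k m g
    have hlim : Tendsto (fun ε : ℝ => ENNReal.ofReal (C * ε)) (𝓝[>] 0) (𝓝 0) := by
      have : Tendsto (fun ε : ℝ => ENNReal.ofReal (C * ε)) (𝓝 0) (𝓝 (ENNReal.ofReal (C * 0))) :=
        (ENNReal.continuous_ofReal.comp (continuous_const_mul C)).tendsto 0
      rw [mul_zero, ENNReal.ofReal_zero] at this
      exact this.mono_left nhdsWithin_le_nhds
    refine tendsto_of_tendsto_of_tendsto_of_le_of_le' tendsto_const_nhds hlim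
      (.of_forall fun _ => zero_le) ?_
    filter_upwards [Ioo_mem_nhdsGT one_pos] with ε hε
    refine iSup_le fun x => ENNReal.ofReal_le_ofReal ?_
    simp only [sub_zero, conv_dil_eq_smul_dilConv]
    refine hC (ε ^ n) ε ?_ hε.1 hε.2 x
    rw [abs_of_pos (pow_pos hε.1 n)]
    exact pow_le_one₀ hε.1.le hε.2.le
  · obtain ⟨h, p, hp⟩ := exists_mderiv_smul_dilConv f g I
    obtain ⟨C, hC0, hC⟩ := f.exists_dilConv_le hf h N
    refine ⟨C + 1, 1, by positivity, one_pos, fun ε h0 h1 x => ?_⟩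
    rw [conv_dil_eq_smul_dilConv, hp, Real.rpow_one]
    have hε : ε ^ n * ε ^ p ≤ 1 :=
      mul_le_one₀ (pow_le_one₀ h0.le h1.le) (by positivity) (pow_le_one₀ h0.le h1.le)
    calc _ ≤ (1 + ‖x‖) ^ N * ‖dilConv f h ε x‖ := by
          rw [norm_smul, Real.norm_eq_abs, abs_of_pos (by positivity)]
          gcongr
          exact mul_le_of_le_one_left (norm_nonneg _) hε
      _ ≤ C * ε := hC ε h0 h1 x
      _ ≤ (C + 1) * ε := by gcongr; linarith

end
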